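/- arXiv:2006.12648 — 2 statements merged into one kernel-verified Lean document; each statement's English description precedes it below -/
import Mathlib

section
/- Let (X, d_X) and (Y, d_Y) be metric spaces, let x : Fin m → X and y : Fin n → Y be time series with x and y injective (no duplicate elements), and let A ∈ {0,1}^{m×n} be an alignment matrix. If Σ_{i,j,k,l} (d_X(x_i,x_k) - d_Y(y_j,y_l))² A_{ij} A_{kl} = 0, then m = n, A is the identity matrix (A_{ii} = 1 for all i and A_{ij} = 0 for i ≠ j), and d_X(x_i,x_k) = d_Y(y_i,y_k) for all i,k; in particular the map x_i ↦ y_i is a metric isometry between the images of x and y. -/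
/-- The "up" predecessor `A_{i-1,j} = 1` exists (requires `i > 0`). -/
def predUp {m n : ℕ} (A : Matrix (Fin m) (Fin n) ℝ) (i : Fin m) (j : Fin n) : Prop :=
  0 < (i : ℕ) ∧ A ⟨(i : ℕ) - 1, lt_of_le_of_lt (Nat.sub_le _ _) i.isLt⟩ j = 1

/-- The "left" predecessor `A_{i,j-1} = 1` exists (requires `j > 0`). -/
def predLeft {m n : ℕ} (A : Matrix (Fin m) (Fin n) ℝ) (i : Fin m) (j : Fin n) : Prop :=
  0 < (j : ℕ) ∧ A i ⟨(j : ℕ) - 1, lt_of_le_of_lt (Nat.sub_le _ _) j.isLt⟩ = 1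

/-- The "diagonal" predecessor `A_{i-1,j-1} = 1` exists (requires `i > 0` and `j > 0`). -/
def predDiag {m n : ℕ} (A : Matrix (Fin m) (Fin n) ℝ) (i : Fin m) (j : Fin n) : Prop :=
  0 < (i : ℕ) ∧ 0 < (j : ℕ) ∧
    A ⟨(i : ℕ) - 1, lt_of_le_of_lt (Nat.sub_le _ _) i.isLt⟩
      ⟨(j : ℕ) - 1, lt_of_le_of_lt (Nat.sub_le _ _) j.isLt⟩ = 1

/-- `A ∈ {0,1}^{m×n}` is an alignment matrix: `A_{1,1} = 1`, `A_{m,n} = 1`, and every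
`(i,j) ≠ (1,1)` with `A_{i,j} = 1` has exactly one of the three predecessors
`A_{i-1,j} = 1`, `A_{i,j-1} = 1`, `A_{i-1,j-1} = 1` (1-based indexing in the paper,
0-based here). -/
def IsAlignment {m n : ℕ} (A : Matrix (Fin m) (Fin n) ℝ) : Prop :=
  (∀ i j, A i j = 0 ∨ A i j = 1) ∧
  (∀ (hm : 0 < m) (hn : 0 < n), A ⟨0, hm⟩ ⟨0, hn⟩ = 1) ∧
  (∀ (hm : 0 < m) (hn : 0 < n),
      A ⟨m - 1, Nat.sub_lt hm Nat.one_pos⟩ ⟨n - 1, Nat.sub_lt hn Nat.one_pos⟩ = 1) ∧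
  (∀ (i : Fin m) (j : Fin n), A i j = 1 → ¬((i : ℕ) = 0 ∧ (j : ℕ) = 0) →
    (predUp A i j ∧ ¬predLeft A i j ∧ ¬predDiag A i j) ∨
    (¬predUp A i j ∧ predLeft A i j ∧ ¬predDiag A i j) ∨
    (¬predUp A i j ∧ ¬predLeft A i j ∧ predDiag A i j))

/-- If a nonnegatively weighted sum of squared differences over pairs of couplings vanishes, then
the distances agree on every pair of coupled indices. -/
theorem dist_eq_dist_of_sum_eq_zero {X Y ι κ : Type*} [PseudoMetricSpace X] [PseudoMetricSpace Y]
    [Fintype ι] [Fintype κ] {x : ι → X} {y : κ → Y} {A : Matrix ι κ ℝ} (hA : ∀ i j, 0 ≤ A i j)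
    (hzero : ∑ i, ∑ j, ∑ k, ∑ l,
        (dist (x i) (x k) - dist (y j) (y l)) ^ 2 * A i j * A k l = 0)
    {i k : ι} {j l : κ} (hij : A i j ≠ 0) (hkl : A k l ≠ 0) :
    dist (x i) (x k) = dist (y j) (y l) := by
  have hnn (i j k l) : 0 ≤ (dist (x i) (x k) - dist (y j) (y l)) ^ 2 * A i j * A k l :=
    mul_nonneg (mul_nonneg (sq_nonneg _) (hA i j)) (hA k l)
  have hl (i j k) := Finset.sum_nonneg fun l (_ : l ∈ Finset.univ) => hnn i j k l
  have hk (i j) := Finset.sum_nonneg fun k (_ : k ∈ Finset.univ) => hl i j k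
  have hj (i) := Finset.sum_nonneg fun j (_ : j ∈ Finset.univ) => hk i j
  have h1 := (Finset.sum_eq_zero_iff_of_nonneg fun i _ => hj i).1 hzero i (Finset.mem_univ i)
  have h2 := (Finset.sum_eq_zero_iff_of_nonneg fun j _ => hk i j).1 h1 j (Finset.mem_univ j)
  have h3 := (Finset.sum_eq_zero_iff_of_nonneg fun k _ => hl i j k).1 h2 k (Finset.mem_univ k)
  have h4 := (Finset.sum_eq_zero_iff_of_nonneg fun l _ => hnn i j k l).1 h3 l (Finset.mem_univ l)
  simpa [hij, hkl, sub_eq_zero] using h4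

namespace IsAlignment

variable {m n : ℕ} {A : Matrix (Fin m) (Fin n) ℝ}

/-- If no row or column contains two ones, the predecessor of an entry is always diagonal. -/
theorem predDiag_of_unique (hA : IsAlignment A)
    (hinj : ∀ i j k l, A i j = 1 → A k l = 1 → (i = k ↔ j = l))
    {i : Fin m} {j : Fin n} (hij : A i j = 1) (h0 : ¬((i : ℕ) = 0 ∧ (j : ℕ) = 0)) :
    predDiag A i j := by
  rcases hA.2.2.2 i j hij h0 with ⟨⟨hi, h⟩, -⟩ | ⟨-, ⟨hj, h⟩, -⟩ | ⟨-, -, h⟩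
  · have := congrArg Fin.val ((hinj _ _ _ _ hij h).2 rfl)
    simp only at this
    omega
  · have := congrArg Fin.val ((hinj _ _ _ _ hij h).1 rfl)
    simp only at this
    omega
  · exact h

/-- If no row or column contains two ones, all ones lie on the diagonal. -/
theorem val_eq_val_of_unique (hA : IsAlignment A)
    (hinj : ∀ i j k l, A i j = 1 → A k l = 1 → (i = k ↔ j = l))
    {i : Fin m} {j : Fin n} (hij : A i j = 1) : (i : ℕ) = j := by
  induction hs : (i : ℕ) using Nat.strong_induction_on generalizing i j with
  | _ s ih =>
    by_cases h0 : (i : ℕ) = 0 ∧ (j : ℕ) = 0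
    · omega
    · obtain ⟨hi, hj, h⟩ := hA.predDiag_of_unique hinj hij h0
      have := ih (i - 1) (by omega) h rfl
      simp only at this
      omega

/-- If no row or column contains two ones, the matrix is square. -/
theorem eq_of_unique (hA : IsAlignment A) (hm : 0 < m) (hn : 0 < n)
    (hinj : ∀ i j k l, A i j = 1 → A k l = 1 → (i = k ↔ j = l)) : m = n := by
  have := hA.val_eq_val_of_unique hinj (hA.2.2.1 hm hn)
  simp only at this
  omega

/-- If no row or column of a square alignment matrix contains two ones, its diagonal entries
are ones. -/
theorem apply_self_of_unique {A : Matrix (Fin n) (Fin n) ℝ} (hA : IsAlignment A)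
    (hinj : ∀ i j k l, A i j = 1 → A k l = 1 → (i = k ↔ j = l)) (i : Fin n) : A i i = 1 := by
  have hn : 0 < n := i.pos
  have key : ∀ k (hk : k ≤ n - 1), A ⟨k, by omega⟩ ⟨k, by omega⟩ = 1 := by
    intro k hk
    induction hk using Nat.decreasingInduction with
    | self => exact hA.2.2.1 hn hn
    | of_succ k hk ih => exact (hA.predDiag_of_unique hinj ih (by simp)).2.2
  exact key i (by omega)

end IsAlignment

/-- If `x` and `y` have no duplicate elements, `A` is an alignment
matrix, and the squared-error GDTW objective at `A` vanishes, then `m = n`, `A` is the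
identity matrix, and `d_X(x_i,x_k) = d_Y(y_i,y_k)` for all `i,k`; in particular
`x_i ↦ y_i` is a metric isometry between the images of `x` and `y`. -/
theorem gdtw_objective_eq_zero_implies_isometry
    {X Y : Type*} [MetricSpace X] [MetricSpace Y] {m n : ℕ} (hm : 1 ≤ m) (hn : 1 ≤ n)
    (x : Fin m → X) (y : Fin n → Y)
    (hx : Function.Injective x) (hy : Function.Injective y)
    (A : Matrix (Fin m) (Fin n) ℝ) (hA : IsAlignment A)
    (hzero : ∑ i, ∑ j, ∑ k, ∑ l,
        (dist (x i) (x k) - dist (y j) (y l)) ^ 2 * A i j * A k l = 0) :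
    m = n ∧
      (∀ (i : Fin m) (j : Fin n), A i j = if (i : ℕ) = (j : ℕ) then 1 else 0) ∧
      (∀ (i k : Fin m) (hi : (i : ℕ) < n) (hk : (k : ℕ) < n),
        dist (x i) (x k) = dist (y ⟨i, hi⟩) (y ⟨k, hk⟩)) := by
  have hnn (i j) : 0 ≤ A i j := by rcases hA.1 i j with h | h <;> simp [h]
  have hdist {i j k l} (hij : A i j = 1) (hkl : A k l = 1) :
      dist (x i) (x k) = dist (y j) (y l) :=
    dist_eq_dist_of_sum_eq_zero hnn hzero (by simp [hij]) (by simp [hkl])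
  have hinj (i j k l) (hij : A i j = 1) (hkl : A k l = 1) : i = k ↔ j = l := by
    rw [← hx.eq_iff, ← hy.eq_iff, ← dist_eq_zero, hdist hij hkl, dist_eq_zero]
  obtain rfl : m = n := hA.eq_of_unique hm hn hinj
  have hdiag := hA.apply_self_of_unique hinj
  refine ⟨rfl, fun i j => ?_, fun i k _ _ => hdist (hdiag i) (hdiag k)⟩
  split_ifs with h
  · obtain rfl := Fin.ext h
    exact hdiag i
  · exact (hA.1 i j).resolve_right fun h1 => h (hA.val_eq_val_of_unique hinj h1)
end

section
/- (Barycenter closed form, Proposition 1.) Let T, T_1, …, T_J ∈ ℕ, let α ∈ ℝ^J with α_j ≥ 0 and Σ_j α_j = 1, let D_j ∈ ℝ^{T_j × T_j} be symmetric matrices, and let A_j ∈ {0,1}^{T × T_j} be alignment matrices. Define the objective f : ℝ^{T×T} → ℝ by f(D) = Σ_{j=1}^J α_j Σ_{i,k=1}^{T} Σ_{p,q=1}^{T_j} (D_{ik} - (D_j)_{pq})² (A_j)_{ip} (A_j)_{kq}. Suppose every entry of the matrix M ∈ ℝ^{T×T} with M_{ik} = Σ_{j=1}^J α_j (A_j 𝟏)_i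 (A_j 𝟏)_k is strictly positive, where 𝟏 ∈ ℝ^{T_j} is the vector of ones. Then f attains its minimum over ℝ^{T×T} at the matrix D* given entrywise by D*_{ik} = ( Σ_{j=1}^J α_j (A_j D_j A_jᵀ)_{ik} ) / M_{ik}, and D* is the unique minimizer. -/
/-- Expansion of a bilinearly weighted sum of squared deviations as a quadratic in `x`. -/
theorem sum_sq_sub_mul_mul {ι κ : Type*} [Fintype ι] [Fintype κ] (x : ℝ) (d : ι → κ → ℝ)
    (a : ι → ℝ) (b : κ → ℝ) :
    ∑ p, ∑ q, (x - d p q) ^ 2 * a p * b q =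
      (∑ p, a p) * (∑ q, b q) * x ^ 2 - 2 * x * (∑ p, ∑ q, a p * d p q * b q) +
        ∑ p, ∑ q, d p q ^ 2 * a p * b q := by
  rw [Finset.sum_mul_sum]
  simp only [Finset.sum_mul, Finset.mul_sum, ← Finset.sum_sub_distrib, ← Finset.sum_add_distrib]
  refine Finset.sum_congr rfl fun p _ => Finset.sum_congr rfl fun q _ => ?_
  ring

theorem sum_mul_sum_sum_comm {ι κ μ : Type*} [Fintype ι] [Fintype κ] [Fintype μ] (c : μ → ℝ)
    (g : μ → ι → κ → ℝ) :
    ∑ j, c j * ∑ i, ∑ k, g j i k = ∑ i, ∑ k, ∑ j, c j * g j i k := by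
  simp only [Finset.mul_sum]
  rw [Finset.sum_comm]
  exact Finset.sum_congr rfl fun i _ => Finset.sum_comm

/-- **Proposition 1, barycenter closed form.** For weights `α ∈ Δ_J`,
symmetric matrices `D_j ∈ ℝ^{T_j×T_j}`, and alignment matrices `A_j ∈ {0,1}^{T×T_j}`,
the objective `f(D) = Σ_j α_j Σ_{i,k,p,q} (D_{ik} - (D_j)_{pq})² (A_j)_{ip} (A_j)_{kq}`
attains its minimum over `ℝ^{T×T}` at
`D*_{ik} = (Σ_j α_j (A_j D_j A_jᵀ)_{ik}) / M_{ik}` with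
`M_{ik} = Σ_j α_j (A_j 𝟏)_i (A_j 𝟏)_k`, provided every `M_{ik} > 0`; and `D*` is the
unique minimizer. -/
theorem gdtw_barycenter_closed_form {J T : ℕ} (Tj : Fin J → ℕ)
    (α : Fin J → ℝ) (hα0 : ∀ j, 0 ≤ α j) (hα1 : ∑ j, α j = 1)
    (D : ∀ j : Fin J, Matrix (Fin (Tj j)) (Fin (Tj j)) ℝ)
    (hDsymm : ∀ j, (D j).IsSymm)
    (A : ∀ j : Fin J, Matrix (Fin T) (Fin (Tj j)) ℝ)
    (hA : ∀ j, IsAlignment (A j))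
    (f : Matrix (Fin T) (Fin T) ℝ → ℝ)
    (hf : ∀ Dm : Matrix (Fin T) (Fin T) ℝ,
      f Dm = ∑ j, α j * ∑ i, ∑ k, ∑ p, ∑ q,
        (Dm i k - D j p q) ^ 2 * A j i p * A j k q)
    (M : Matrix (Fin T) (Fin T) ℝ)
    (hM : ∀ i k, M i k = ∑ j, α j * (∑ p, A j i p) * (∑ q, A j k q))
    (hMpos : ∀ i k, 0 < M i k)
    (Dstar : Matrix (Fin T) (Fin T) ℝ)
    (hDstar : ∀ i k,
      Dstar i k = (∑ j, α j * ∑ p, ∑ q, A j i p * D j p q * A j k q) / M i k) :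
    (∀ Dm : Matrix (Fin T) (Fin T) ℝ, f Dstar ≤ f Dm) ∧
      ∀ Dm : Matrix (Fin T) (Fin T) ℝ, f Dm ≤ f Dstar → Dm = Dstar := by
  have f_eq : ∀ X : Matrix (Fin T) (Fin T) ℝ, f X = ∑ i, ∑ k,
      (M i k * X i k ^ 2 - 2 * X i k * (M i k * Dstar i k) +
        ∑ j, α j * ∑ p, ∑ q, D j p q ^ 2 * A j i p * A j k q) := by
    intro X
    rw [hf]
    rw [sum_mul_sum_sum_comm]
    refine Finset.sum_congr rfl fun i _ => Finset.sum_congr rfl fun k _ => ?_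
    rw [hDstar i k, mul_div_cancel₀ _ (hMpos i k).ne', hM i k, Finset.sum_mul, Finset.mul_sum,
      ← Finset.sum_sub_distrib, ← Finset.sum_add_distrib]
    refine Finset.sum_congr rfl fun j _ => ?_
    rw [sum_sq_sub_mul_mul (X i k) (D j) (A j i) (A j k)]
    ring
  have f_sub : ∀ X : Matrix (Fin T) (Fin T) ℝ,
      f X - f Dstar = ∑ i, ∑ k, M i k * (X i k - Dstar i k) ^ 2 := by
    intro X
    simp only [f_eq, ← Finset.sum_sub_distrib]
    refine Finset.sum_congr rfl fun i _ => Finset.sum_congr rfl fun k _ => ?_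
    ring
  have term_nonneg : ∀ (X : Matrix (Fin T) (Fin T) ℝ) i k,
      0 ≤ M i k * (X i k - Dstar i k) ^ 2 :=
    fun X i k => mul_nonneg (hMpos i k).le (sq_nonneg _)
  have row_nonneg : ∀ (X : Matrix (Fin T) (Fin T) ℝ) i,
      0 ≤ ∑ k, M i k * (X i k - Dstar i k) ^ 2 :=
    fun X i => Finset.sum_nonneg fun k _ => term_nonneg X i k
  refine ⟨fun X => ?_, fun X hX => ?_⟩
  · rw [← sub_nonneg, f_sub]
    exact Finset.sum_nonneg fun i _ => row_nonneg X i
  · have sum_zero : ∑ i, ∑ k, M i k * (X i k - Dstar i k) ^ 2 = 0 :=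
      le_antisymm (f_sub X ▸ sub_nonpos.2 hX) (Finset.sum_nonneg fun i _ => row_nonneg X i)
    ext i k
    have row_zero := (Finset.sum_eq_zero_iff_of_nonneg fun i _ => row_nonneg X i).1 sum_zero i
      (Finset.mem_univ i)
    have term_zero := (Finset.sum_eq_zero_iff_of_nonneg fun k _ => term_nonneg X i k).1 row_zero k
      (Finset.mem_univ k)
    exact sub_eq_zero.1 (pow_eq_zero_iff two_ne_zero |>.1
      ((mul_eq_zero.1 term_zero).resolve_left (hMpos i k).ne'))
end
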